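/- arXiv:2310.14754 — 3 statements merged into one kernel-verified Lean document; each statement's English description precedes it below -/
import Mathlib

section
/- Fix q ∈ ℕ, an invertible matrix A = (a_{jℓ})_{0≤j,ℓ≤q} of real numbers, and a vector b = (b_j)_{0≤j≤q} of nonnegative reals. Then there exists a constant C > 0, depending only on q, A and b, with the following property: for every interval Ω_k = (x_k − Δx_k/2, x_k + Δx_k/2) with 0 < Δx_k ≤ 1, for every family of bounded measurable functions v_0, …, v_q : Ω_k → ℝ satisfying |v_j(x) − Σ_{ℓ=0}^q a_{jℓ}(x − x_k)^ℓ| ≤ b_j (Δx_k)^{q+1} for all j ∈ {0,…,q} and all x ∈ Ω_k, and for every u ∈ H^{q+1}(Ω_k), there exists v_h in the linear span of (v_0, …, v_q) such that ‖v_h − u‖_{L∞(Ω_k)} ≤ C ‖u‖_{H^{q+1}(Ω_k)} (Δx_k)^{q+1/2}. -/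
open MeasureTheory

/-- The `H^{q+1}` Sobolev norm of `u` on a set `s ⊆ ℝ`:
`(∑_{m=0}^{q+1} ‖u^{(m)}‖²_{L²(s)})^{1/2}`. -/
noncomputable def sobolevNormOn (q : ℕ) (s : Set ℝ) (u : ℝ → ℝ) : ℝ :=
  Real.sqrt (∑ m ∈ Finset.range (q + 2), ∫ x in s, (iteratedDerivWithin m u s x) ^ 2)

lemma ys_cs (a c r N : ℝ) (hr : 0 < r) (hac : c - a = r ^ 2) (hN : 0 ≤ N) (g : ℝ → ℝ)
    (hg : ContinuousOn g (Set.Ioo a c))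
    (hi : IntegrableOn (fun x => g x ^ 2) (Set.Ioo a c))
    (hb : ∫ x in Set.Ioo a c, g x ^ 2 ≤ N ^ 2) :
    IntegrableOn (fun x => |g x|) (Set.Ioo a c) ∧ ∫ x in Set.Ioo a c, |g x| ≤ r * N := by
  have hm : AEStronglyMeasurable g (volume.restrict (Set.Ioo a c)) :=
    hg.aestronglyMeasurable measurableSet_Ioo
  have h1 : IntegrableOn (fun _ : ℝ => (1 : ℝ)) (Set.Ioo a c) := by
    simp [integrableOn_const_iff]
  have hI : IntegrableOn (fun x => |g x|) (Set.Ioo a c) := by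
    refine Integrable.mono' (h1.add hi) hm.norm (ae_of_all _ fun x => ?_)
    simp only [Pi.add_apply, Real.norm_eq_abs, abs_abs]
    nlinarith [sq_abs (g x), sq_nonneg (|g x| - 1)]
  refine ⟨hI, ?_⟩
  set I := ∫ x in Set.Ioo a c, |g x| with hIdef
  have hvol : ∫ _ in Set.Ioo a c, (1 : ℝ) = r ^ 2 := by
    simp [hac, Measure.real, ENNReal.toReal_ofReal, sq_nonneg]
  have key : 0 ≤ ∫ x in Set.Ioo a c, (g x ^ 2 - (2 * (I / r ^ 2)) * |g x| + (I / r ^ 2) ^ 2 * 1) := by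
    refine integral_nonneg fun x => ?_
    simp only [Pi.zero_apply]
    nlinarith [sq_abs (g x), sq_nonneg (|g x| - I / r ^ 2)]
  have hsub : IntegrableOn (fun x => g x ^ 2 - (2 * (I / r ^ 2)) * |g x|) (Set.Ioo a c) :=
    hi.sub (hI.const_mul _)
  rw [integral_add hsub (h1.const_mul _), integral_sub hi (hI.const_mul _),
    integral_const_mul, integral_const_mul, hvol, ← hIdef] at key
  have e : 2 * (I / r ^ 2) * I - (I / r ^ 2) ^ 2 * r ^ 2 = I ^ 2 / r ^ 2 := by
    field_simp; ring
  have : I ^ 2 / r ^ 2 ≤ N ^ 2 := by linarith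
  rw [div_le_iff₀ (by positivity)] at this
  refine abs_le_of_sq_le_sq' (by nlinarith) (by positivity) |>.2

lemma ys_osc (a c r N : ℝ) (hr : 0 < r) (hac : c - a = r ^ 2) (hN : 0 ≤ N) (g g' : ℝ → ℝ)
    (hd : ∀ x ∈ Set.Ioo a c, HasDerivAt g (g' x) x)
    (hg : ContinuousOn g' (Set.Ioo a c))
    (hi : IntegrableOn (fun x => g' x ^ 2) (Set.Ioo a c))
    (hb : ∫ x in Set.Ioo a c, g' x ^ 2 ≤ N ^ 2) (x y : ℝ)
    (hx : x ∈ Set.Ioo a c) (hy : y ∈ Set.Ioo a c) : |g x - g y| ≤ r * N := by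
  obtain ⟨hI, hle⟩ := ys_cs a c r N hr hac hN g' hg hi hb
  have hsub : Set.uIcc y x ⊆ Set.Ioo a c := Set.ordConnected_Ioo.uIcc_subset hy hx
  have hint : IntervalIntegrable g' volume y x := (hg.mono hsub).intervalIntegrable
  rw [← intervalIntegral.integral_eq_sub_of_hasDerivAt (fun t ht => hd t (hsub ht)) hint]
  have h := intervalIntegral.norm_integral_le_integral_norm_uIoc (f := g') (μ := volume) (a := y) (b := x)
  simp only [Real.norm_eq_abs] at h
  refine h.trans (le_trans ?_ hle)
  exact setIntegral_mono_set hI (ae_of_all _ fun t => abs_nonneg _)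
    (Filter.Eventually.of_forall (Set.uIoc_subset_uIcc.trans hsub))

lemma ys_sup (a c r N : ℝ) (hr : 0 < r) (hr1 : r ≤ 1) (hac : c - a = r ^ 2) (hN : 0 ≤ N)
    (g g' : ℝ → ℝ)
    (hd : ∀ x ∈ Set.Ioo a c, HasDerivAt g (g' x) x)
    (hg : ContinuousOn g' (Set.Ioo a c))
    (hi0 : IntegrableOn (fun x => g x ^ 2) (Set.Ioo a c))
    (hb0 : ∫ x in Set.Ioo a c, g x ^ 2 ≤ N ^ 2)
    (hi : IntegrableOn (fun x => g' x ^ 2) (Set.Ioo a c))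
    (hb : ∫ x in Set.Ioo a c, g' x ^ 2 ≤ N ^ 2) (x : ℝ)
    (hx : x ∈ Set.Ioo a c) : |g x| ≤ 2 * N / r := by
  have hc0 : ContinuousOn g (Set.Ioo a c) := fun t ht => (hd t ht).continuousAt.continuousWithinAt
  obtain ⟨hI, hle⟩ := ys_cs a c r N hr hac hN g hc0 hi0 hb0
  have h1 : ∀ k : ℝ, IntegrableOn (fun _ : ℝ => k) (Set.Ioo a c) := by
    intro k; simp [integrableOn_const_iff]
  have hvol : ∀ k : ℝ, ∫ _ in Set.Ioo a c, k = r ^ 2 * k := by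
    intro k
    simp [hac, Measure.real, ENNReal.toReal_ofReal, sq_nonneg]
  have h := setIntegral_mono_on (h1 |g x|) (hI.add (h1 (r * N))) measurableSet_Ioo
    (fun y hy => by
      have := ys_osc a c r N hr hac hN g g' hd hg hi hb x y hx hy
      have h2 := abs_sub_abs_le_abs_sub (g x) (g y)
      simp only [Pi.add_apply]
      linarith)
  simp only [Pi.add_apply] at h
  rw [integral_add hI (h1 _), hvol, hvol] at h
  rw [le_div_iff₀ hr]
  have h3 : r ^ 2 * (r * N) ≤ r * N := by
    have : r ^ 2 ≤ 1 := by nlinarith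
    nlinarith [mul_nonneg hr.le hN]
  have h4 : r * (|g x| * r) ≤ r * (2 * N) := by nlinarith
  exact le_of_mul_le_mul_left h4 hr

lemma ys_taylor (s : Set ℝ) (hs : Convex ℝ s) (a h S : ℝ) (ha : a ∈ s) (hS : 0 ≤ S)
    (hh : 0 ≤ h) (hsh : ∀ x ∈ s, |x - a| ≤ h) (n : ℕ) : ∀ (D : ℕ → ℝ → ℝ),
    (∀ m < n, ∀ x ∈ s, HasDerivAt (D m) (D (m + 1) x) x) →
    (∀ x ∈ s, |D n x - D n a| ≤ S) →
    ∀ x ∈ s, |D 0 x - ∑ l ∈ Finset.range (n + 1), D l a / (l.factorial : ℝ) * (x - a) ^ l|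
      ≤ S * h ^ n := by
  induction n with
  | zero =>
    intro D _ h2 x hx
    simpa using h2 x hx
  | succ n ih =>
    intro D h1 h2 x hx
    have IH := ih (fun m => D (m + 1)) (fun m hm x hx => h1 (m + 1) (by omega) x hx) h2
    have hder : ∀ y ∈ s, HasDerivAt
        (fun x => D 0 x - ∑ l ∈ Finset.range (n + 1 + 1), D l a / (l.factorial : ℝ) * (x - a) ^ l)
        (D 1 y - ∑ l ∈ Finset.range (n + 1), D (l + 1) a / (l.factorial : ℝ) * (y - a) ^ l) y := by
      intro y hy
      refine (h1 0 (by omega) y hy).sub ?_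
      have hsum : HasDerivAt (fun x => ∑ l ∈ Finset.range (n + 1 + 1), D l a / (l.factorial : ℝ) * (x - a) ^ l)
        (∑ l ∈ Finset.range (n + 1 + 1), D l a / (l.factorial : ℝ) * ((l : ℝ) * (y - a) ^ (l - 1) * 1)) y := by
        refine HasDerivAt.fun_sum fun l _ => ?_
        exact (((hasDerivAt_id y).sub_const a).fun_pow l).const_mul _
      refine hsum.congr_deriv ?_
      rw [Finset.sum_range_succ' _ (n + 1)]
      simp only [Nat.cast_zero, zero_mul, mul_zero, add_zero]
      refine Finset.sum_congr rfl fun l _ => ?_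
      rw [Nat.factorial_succ]
      have : (l.factorial : ℝ) ≠ 0 := by positivity
      have : (l : ℝ) + 1 ≠ 0 := by positivity
      push_cast
      try simp only [Nat.add_sub_cancel]
      field_simp
    have := hs.norm_image_sub_le_of_norm_hasDerivWithin_le (C := S * h ^ n)
      (fun y hy => (hder y hy).hasDerivWithinAt) (fun y hy => IH y hy) ha hx
    have h0 : D 0 a - ∑ l ∈ Finset.range (n + 1 + 1), D l a / (l.factorial : ℝ) * (a - a) ^ l = 0 := by
      rw [Finset.sum_range_succ']
      simp
    rw [h0, sub_zero, Real.norm_eq_abs, Real.norm_eq_abs] at this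
    refine this.trans ?_
    rw [pow_succ, ← mul_assoc]
    exact mul_le_mul_of_nonneg_left (hsh x hx) (by positivity)

/-- Yuan–Shu approximation lemma for non-polynomial DG bases:
if each basis function `v j` is, on the cell `Ω_k = (x_k - Δx_k/2, x_k + Δx_k/2)`,
within `b j * Δx_k^(q+1)` of the polynomial `∑_ℓ A j ℓ (x - x_k)^ℓ` (with `A` invertible
and `b` nonnegative), then every `u ∈ H^{q+1}(Ω_k)` is approximated in `L^∞(Ω_k)` by an
element of the span of the `v j` with error `≤ C ‖u‖_{H^{q+1}(Ω_k)} Δx_k^{q+1/2}`,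
where `C > 0` depends only on `q`, `A` and `b`. -/
theorem yuan_shu_nonpolynomial_basis_approximation
    (q : ℕ) (A : Matrix (Fin (q + 1)) (Fin (q + 1)) ℝ) (hA : IsUnit A.det)
    (b : Fin (q + 1) → ℝ) (hb : ∀ j, 0 ≤ b j) :
    ∃ C : ℝ, 0 < C ∧
      ∀ (xk Δx : ℝ), 0 < Δx → Δx ≤ 1 →
        ∀ v : Fin (q + 1) → ℝ → ℝ,
          (∀ j, Measurable (v j)) →
          (∀ j, ∃ B : ℝ, ∀ x ∈ Set.Ioo (xk - Δx / 2) (xk + Δx / 2), |v j x| ≤ B) →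
          (∀ j, ∀ x ∈ Set.Ioo (xk - Δx / 2) (xk + Δx / 2),
              |v j x - ∑ ℓ : Fin (q + 1), A j ℓ * (x - xk) ^ (ℓ : ℕ)| ≤ b j * Δx ^ (q + 1)) →
          ∀ u : ℝ → ℝ,
            ContDiffOn ℝ (q + 1 : ℕ) u (Set.Ioo (xk - Δx / 2) (xk + Δx / 2)) →
            (∀ m ≤ q + 1,
              IntegrableOn
                (fun x => (iteratedDerivWithin m u (Set.Ioo (xk - Δx / 2) (xk + Δx / 2)) x) ^ 2)
                (Set.Ioo (xk - Δx / 2) (xk + Δx / 2))) →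
            ∃ c : Fin (q + 1) → ℝ,
              ∀ x ∈ Set.Ioo (xk - Δx / 2) (xk + Δx / 2),
                |(∑ j : Fin (q + 1), c j * v j x) - u x| ≤
                  C * sobolevNormOn q (Set.Ioo (xk - Δx / 2) (xk + Δx / 2)) u *
                    Δx ^ ((q : ℝ) + 1 / 2) := by
  refine ⟨1 + 2 * ∑ j, (∑ l, |A⁻¹ l j|) * b j, ?_, ?_⟩
  · have : 0 ≤ ∑ j, (∑ l, |A⁻¹ l j|) * b j :=
      Finset.sum_nonneg fun j _ => mul_nonneg (Finset.sum_nonneg fun l _ => abs_nonneg _) (hb j)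
    linarith
  intro xk Δx h0 h1 v _ _ hv u hu hint
  set a := xk - Δx / 2 with ha
  set c := xk + Δx / 2 with hc
  set N := sobolevNormOn q (Set.Ioo a c) u with hNdef
  set r := Real.sqrt Δx with hr
  have hr0 : 0 < r := Real.sqrt_pos.2 h0
  have hrsq : r ^ 2 = Δx := Real.sq_sqrt h0.le
  have hr1 : r ≤ 1 := Real.sqrt_le_one.2 h1
  have hac : c - a = r ^ 2 := by rw [hrsq, ha, hc]; ring
  have hN : 0 ≤ N := Real.sqrt_nonneg _
  have hxk : xk ∈ Set.Ioo a c := ⟨by linarith, by linarith⟩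
  set D : ℕ → ℝ → ℝ := fun m => iteratedDerivWithin m u (Set.Ioo a c) with hD
  have hUD : UniqueDiffOn ℝ (Set.Ioo a c) := uniqueDiffOn_Ioo a c
  have hcont : ∀ m ≤ q + 1, ContinuousOn (D m) (Set.Ioo a c) := fun m hm =>
    hu.continuousOn_iteratedDerivWithin (by exact_mod_cast hm) hUD
  have hder : ∀ m < q + 1, ∀ x ∈ Set.Ioo a c, HasDerivAt (D m) (D (m + 1) x) x := by
    intro m hm x hx
    have hdiff := (hu.differentiableOn_iteratedDerivWithin (m := m) (by exact_mod_cast hm) hUD) x hx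
    have := hdiff.hasDerivWithinAt
    rw [← iteratedDerivWithin_succ] at this
    exact this.hasDerivAt (isOpen_Ioo.mem_nhds hx)
  have hnorm : ∀ m ≤ q + 1, ∫ x in Set.Ioo a c, D m x ^ 2 ≤ N ^ 2 := by
    intro m hm
    have hnn : ∀ i ∈ Finset.range (q + 2), 0 ≤ ∫ x in Set.Ioo a c, D i x ^ 2 :=
      fun i _ => integral_nonneg fun x => sq_nonneg _
    rw [hNdef, sobolevNormOn, Real.sq_sqrt (Finset.sum_nonneg hnn)]
    exact Finset.single_le_sum hnn (Finset.mem_range.2 (by omega))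
  have hsup : ∀ m ≤ q, |D m xk| ≤ 2 * N / r := fun m hm =>
    ys_sup a c r N hr0 hr1 hac hN (D m) (D (m + 1)) (hder m (by omega)) (hcont _ (by omega))
      (hint m (by omega)) (hnorm m (by omega)) (hint (m + 1) (by omega)) (hnorm _ (by omega)) xk hxk
  have htay := ys_taylor (Set.Ioo a c) (convex_Ioo a c) xk Δx (r * N) hxk (by positivity) h0.le
    (fun x hx => abs_le.2 ⟨by linarith [hx.1], by linarith [hx.2]⟩) q D
    (fun m hm => hder m (by omega))
    (fun x hx => ys_osc a c r N hr0 hac hN (D q) (D (q + 1)) (hder q (by omega)) (hcont _ le_rfl)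
      (hint _ le_rfl) (hnorm _ le_rfl) x xk hx hxk)
  set α : Fin (q + 1) → ℝ := fun l => D l xk / ((l : ℕ).factorial : ℝ) with hα
  have hαb : ∀ l, |α l| ≤ 2 * N / r := by
    intro l
    rw [hα]
    simp only [abs_div, Nat.abs_cast]
    exact (div_le_self (abs_nonneg _) (by exact_mod_cast Nat.factorial_pos _)).trans
      (hsup l (by omega))
  refine ⟨Matrix.vecMul α A⁻¹, fun x hx => ?_⟩
  set d := Matrix.vecMul α A⁻¹ with hd
  have hdA : ∀ l, ∑ j, d j * A j l = α l := by
    intro l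
    have : Matrix.vecMul d A = α := by
      rw [hd, Matrix.vecMul_vecMul, Matrix.nonsing_inv_mul A hA, Matrix.vecMul_one]
    exact congrFun this l
  have hdb : ∀ j, |d j| ≤ 2 * N / r * ∑ l, |A⁻¹ l j| := by
    intro j
    have : d j = ∑ l, α l * A⁻¹ l j := rfl
    rw [this, Finset.mul_sum]
    refine (Finset.abs_sum_le_sum_abs _ _).trans (Finset.sum_le_sum fun l _ => ?_)
    rw [abs_mul]
    exact mul_le_mul_of_nonneg_right (hαb l) (abs_nonneg _)
  have hpoly : ∑ j, d j * ∑ l : Fin (q + 1), A j l * (x - xk) ^ (l : ℕ)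
      = ∑ l ∈ Finset.range (q + 1), D l xk / (l.factorial : ℝ) * (x - xk) ^ l := by
    rw [Finset.sum_range fun l => D l xk / (l.factorial : ℝ) * (x - xk) ^ l]
    simp only [Finset.mul_sum]
    rw [Finset.sum_comm]
    refine Finset.sum_congr rfl fun l _ => ?_
    change _ = α l * _
    rw [← hdA l, Finset.sum_mul]
    exact Finset.sum_congr rfl fun j _ => by ring
  have hD0 : D 0 x = u x := by simp [hD]
  have ht := htay x hx
  rw [hD0, ← hpoly] at ht
  have hsplit : (∑ j, d j * v j x) - u x
      = ∑ j, d j * (v j x - ∑ l : Fin (q + 1), A j l * (x - xk) ^ (l : ℕ))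
        - (u x - ∑ j, d j * ∑ l : Fin (q + 1), A j l * (x - xk) ^ (l : ℕ)) := by
    simp only [mul_sub, Finset.sum_sub_distrib]
    ring
  have hfirst : |∑ j, d j * (v j x - ∑ l : Fin (q + 1), A j l * (x - xk) ^ (l : ℕ))|
      ≤ 2 * N / r * Δx ^ (q + 1) * ∑ j, (∑ l, |A⁻¹ l j|) * b j := by
    rw [Finset.mul_sum]
    refine (Finset.abs_sum_le_sum_abs _ _).trans (Finset.sum_le_sum fun j _ => ?_)
    rw [abs_mul]
    refine (mul_le_mul (hdb j) (hv j x hx) (abs_nonneg _) ((abs_nonneg _).trans (hdb j))).trans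
      (le_of_eq (by ring))
  have hpow : Δx ^ ((q : ℝ) + 1 / 2) = Δx ^ q * r := by
    rw [Real.rpow_add h0, Real.rpow_natCast, hr, Real.sqrt_eq_rpow]
  have hpow2 : 2 * N / r * Δx ^ (q + 1) = 2 * N * (Δx ^ q * r) := by
    rw [pow_succ]
    nth_rewrite 2 [← hrsq]
    field_simp
  rw [hsplit, hpow]
  refine (abs_sub _ _).trans ((add_le_add hfirst ht).trans (le_of_eq ?_))
  rw [hpow2]
  ring
end

section
/- Fix q ∈ ℕ. There exists a constant C > 0 depending only on q with the following property. Let Ω_k = (x_k − Δx_k/2, x_k + Δx_k/2) be a cell with center x_k and length Δx_k > 0, let m > 0, and let u_θ be of class C^{q+1} on the closure of Ω_k with u_θ(x)² > m² for all x ∈ Ω_k. Let P_h denote the orthogonal projection of L²(Ω_k) onto the (q+1)-dimensional subspace V_h^* spanned by the functions x ↦ (x − x_k)^j u_θ(x)/j!, j = 0,…,q. Then for every u ∈ H^{q+1}(Ω_k), ‖u − P_h(u)‖_{L∞(Ω_k)} ≤ C |u/u_θ|_{H^{q+1}(Ω_k)} (Δx_k)^{q+1/2} (1 + ‖u_θ²‖_{L∞(Ω_k)}/m²)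 ‖u_θ‖_{L∞(Ω_k)}. -/
open MeasureTheory

lemma aux_inverse (q : ℕ) : ∃ K : ℝ, 0 < K ∧ ∀ a : Fin (q+1) → ℝ, ∀ s : ℝ, |s| ≤ 1 →
    (∑ j : Fin (q+1), a j * s ^ (j:ℕ)) ^ 2 ≤
      K * ∫ t in (-1/2:ℝ)..(1/2), (∑ j : Fin (q+1), a j * t ^ (j:ℕ)) ^ 2 := by
  let Q : (Fin (q+1) → ℝ) → ℝ := fun a => ∫ t in (-1/2:ℝ)..(1/2), (∑ j : Fin (q+1), a j * t ^ (j:ℕ)) ^ 2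
  have hQc : Continuous Q := by
    apply intervalIntegral.continuous_parametric_intervalIntegral_of_continuous'
    fun_prop
  have hQpos : ∀ a, a ≠ 0 → 0 < Q a := by
    intro a ha
    have hcont : Continuous (fun t : ℝ => (∑ j : Fin (q+1), a j * t ^ (j:ℕ)) ^ 2) := by fun_prop
    by_contra hneg
    have h0 : Q a = 0 := le_antisymm (not_lt.mp hneg)
      (intervalIntegral.integral_nonneg (by norm_num) (fun t _ => sq_nonneg _))
    have hz : ∀ t ∈ Set.Icc (-1/2:ℝ) (1/2), (∑ j : Fin (q+1), a j * t ^ (j:ℕ)) = 0 := by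
      intro t ht
      by_contra hne
      have : 0 < Q a := by
        apply intervalIntegral.integral_pos (by norm_num) hcont.continuousOn (fun t _ => sq_nonneg _)
        exact ⟨t, ht, by positivity⟩
      exact hneg this
    let P : Polynomial ℝ := ∑ j : Fin (q+1), Polynomial.C (a j) * Polynomial.X ^ (j:ℕ)
    have hP : P = 0 := by
      apply Polynomial.eq_zero_of_infinite_isRoot
      apply Set.Infinite.mono _ (Set.Icc_infinite (show (-1/2:ℝ) < 1/2 by norm_num))
      intro t ht
      have := hz t ht
      simpa [P, Polynomial.IsRoot, Polynomial.eval_finsetSum] using this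
    apply ha
    funext i
    have h1 : P.coeff i = 0 := by rw [hP]; simp
    simp only [P, Polynomial.finsetSum_coeff, Polynomial.coeff_C_mul_X_pow] at h1
    rw [Finset.sum_eq_single i] at h1
    · simpa using h1
    · intro b _ hb
      rw [if_neg]
      intro h; exact hb (Fin.ext h.symm)
    · simp
  obtain ⟨a0, ha0, hmin⟩ := (isCompact_sphere (0 : Fin (q+1) → ℝ) 1).exists_isMinOn
    (NormedSpace.sphere_nonempty.mpr zero_le_one) hQc.continuousOn
  have ha0' : a0 ≠ 0 := by
    rintro rfl
    simp at ha0
  have hc := hQpos a0 ha0'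
  have hhom : ∀ (c : ℝ) a, Q (c • a) = c ^ 2 * Q a := by
    intro c a
    simp only [Q]
    rw [← intervalIntegral.integral_const_mul]
    congr 1
    funext t
    rw [← mul_pow, Finset.mul_sum]
    simp [mul_assoc]
  have hlow : ∀ a, Q a0 * ‖a‖ ^ 2 ≤ Q a := by
    intro a
    by_cases ha : a = 0
    · subst ha; simp [Q]
    · have hn : ‖a‖ ≠ 0 := by simpa using ha
      have h1 : Q a0 ≤ Q (‖a‖⁻¹ • a) := hmin (by simp [norm_smul, hn])
      rw [hhom] at h1
      have hn2 : 0 < ‖a‖ ^ 2 := by positivity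
      calc Q a0 * ‖a‖ ^ 2 ≤ (‖a‖⁻¹ ^ 2 * Q a) * ‖a‖ ^ 2 := by gcongr
        _ = Q a := by field_simp
  refine ⟨(q+1)^2 / Q a0, by positivity, ?_⟩
  intro a s hs
  have h1 : |∑ j : Fin (q+1), a j * s ^ (j:ℕ)| ≤ (q+1) * ‖a‖ := by
    calc _ ≤ ∑ j : Fin (q+1), |a j * s ^ (j:ℕ)| := Finset.abs_sum_le_sum_abs _ _
      _ ≤ ∑ j : Fin (q+1), ‖a‖ := by
        apply Finset.sum_le_sum
        intro j _
        rw [abs_mul, abs_pow]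
        have := norm_le_pi_norm a j
        have h2 : |s| ^ (j:ℕ) ≤ 1 := pow_le_one₀ (abs_nonneg _) hs
        rw [Real.norm_eq_abs] at this
        nlinarith [abs_nonneg (a j), norm_nonneg a]
      _ = _ := by simp
  have h3 := hlow a
  calc (∑ j : Fin (q+1), a j * s ^ (j:ℕ)) ^ 2 = |∑ j : Fin (q+1), a j * s ^ (j:ℕ)| ^ 2 := (sq_abs _).symm
    _ ≤ ((q+1) * ‖a‖) ^ 2 := by gcongr
    _ = (q+1)^2 / Q a0 * (Q a0 * ‖a‖ ^ 2) := by field_simp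
    _ ≤ (q+1)^2 / Q a0 * Q a := by gcongr

lemma aux_scaled (q : ℕ) (K : ℝ) (hK : ∀ a : Fin (q+1) → ℝ, ∀ s : ℝ, |s| ≤ 1 →
    (∑ j : Fin (q+1), a j * s ^ (j:ℕ)) ^ 2 ≤
      K * ∫ t in (-1/2:ℝ)..(1/2), (∑ j : Fin (q+1), a j * t ^ (j:ℕ)) ^ 2)
    (a : Fin (q+1) → ℝ) (c h : ℝ) (hh : 0 < h) (x : ℝ) (hx : x ∈ Set.Ioo (c - h/2) (c + h/2)) :
    (∑ j : Fin (q+1), a j * (x - c) ^ (j:ℕ)) ^ 2 * h ≤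
      K * ∫ t in Set.Ioo (c - h/2) (c+h/2), (∑ j : Fin (q+1), a j * (t - c) ^ (j:ℕ)) ^ 2 := by
  have h1 := hK (fun j => a j * h ^ (j:ℕ)) ((x - c) / h) (by
    rw [abs_div, abs_of_pos hh, div_le_one hh, abs_le]
    constructor <;> linarith [hx.1, hx.2])
  rw [← integral_Ioc_eq_integral_Ioo, ← intervalIntegral.integral_of_le (by linarith)]
  have h2 := intervalIntegral.mul_integral_comp_add_mul (a := -1/2) (b := 1/2)
    (f := fun t : ℝ => (∑ j : Fin (q+1), a j * (t - c) ^ (j:ℕ)) ^ 2) h c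
  rw [show c + h * (-1/2) = c - h/2 by ring, show c + h * (1/2) = c + h/2 by ring] at h2
  rw [← h2]
  have e1 : ∀ t : ℝ, (∑ j : Fin (q+1), a j * h ^ (j:ℕ) * t ^ (j:ℕ)) = ∑ j : Fin (q+1), a j * (c + h * t - c) ^ (j:ℕ) := by
    intro t
    apply Finset.sum_congr rfl
    intro j _
    rw [add_sub_cancel_left, mul_pow]; ring
  simp only [e1] at h1
  rw [show c + h * ((x-c)/h) - c = x - c by field_simp; ring] at h1
  calc _ ≤ _ := mul_le_mul_of_nonneg_right h1 hh.le
    _ = _ := by ring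

lemma aux_CS (a b : ℝ) (hab : a < b) (g : ℝ → ℝ) (hg : ContinuousOn g (Set.Ioo a b))
    (hg2 : IntegrableOn (fun t => g t ^ 2) (Set.Ioo a b)) :
    IntegrableOn g (Set.Ioo a b) ∧
    ∫ t in Set.Ioo a b, |g t| ≤ √(b-a) * √(∫ t in Set.Ioo a b, g t ^ 2) := by
  have hm : AEStronglyMeasurable g (volume.restrict (Set.Ioo a b)) :=
    hg.aestronglyMeasurable measurableSet_Ioo
  have hc : ∀ c : ℝ, IntegrableOn (fun _ => c) (Set.Ioo a b) := fun c => by simp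
  have hi : IntegrableOn g (Set.Ioo a b) := by
    refine Integrable.mono' ((hc 1).add hg2) hm ?_
    filter_upwards with t
    simp only [Pi.add_apply, Real.norm_eq_abs]
    nlinarith [sq_abs (g t), sq_nonneg (|g t| - 1), abs_nonneg (g t)]
  refine ⟨hi, ?_⟩
  have hL : 0 < b - a := by linarith
  rw [← Real.sqrt_mul hL.le]
  apply Real.le_sqrt_of_sq_le
  set A := ∫ t in Set.Ioo a b, |g t| with hA
  have h0 : 0 ≤ ∫ t in Set.Ioo a b, (|g t| - A / (b-a))^2 := integral_nonneg (fun t => sq_nonneg _)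
  have h1 : ∫ t in Set.Ioo a b, (|g t| - A / (b-a))^2 =
      (∫ t in Set.Ioo a b, g t ^ 2) - 2 * (A/(b-a)) * A + (A/(b-a))^2 * (b-a) := by
    have : ∀ t, (|g t| - A / (b-a))^2 = g t ^ 2 - 2 * (A/(b-a)) * |g t| + (A/(b-a))^2 := by
      intro t; rw [← sq_abs (g t)]; ring
    simp_rw [this]
    rw [integral_add, integral_sub, integral_const_mul, setIntegral_const]
    · rw [← hA]; simp [hL.le, mul_comm]
    · exact hg2
    · exact hi.abs.const_mul _
    · exact Integrable.sub hg2 (hi.abs.const_mul _)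
    · exact hc _
  rw [h1] at h0
  have h2 : (∫ t in Set.Ioo a b, g t ^ 2) - 2 * (A/(b-a)) * A + (A/(b-a))^2 * (b-a) = (∫ t in Set.Ioo a b, g t ^ 2) - A^2/(b-a) := by
    field_simp; ring
  rw [h2, sub_nonneg, div_le_iff₀ hL] at h0
  linarith

lemma aux_taylor (q : ℕ) (a b : ℝ) (hab : a < b) (w : ℝ → ℝ)
    (hw : ContDiffOn ℝ (q+1:ℕ) w (Set.Ioo a b))
    (hi : IntegrableOn (fun t => (iteratedDerivWithin (q+1) w (Set.Ioo a b) t) ^ 2) (Set.Ioo a b))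
    (x₀ x : ℝ) (hx₀ : x₀ ∈ Set.Ioo a b) (hx : x ∈ Set.Ioo a b) :
    |w x - ∑ j : Fin (q+1), iteratedDeriv j w x₀ / (Nat.factorial j : ℝ) * (x - x₀) ^ (j:ℕ)| ≤
      (b-a)^q * (√(b-a) * √(∫ t in Set.Ioo a b, (iteratedDerivWithin (q+1) w (Set.Ioo a b) t) ^ 2)) := by
  set g := iteratedDerivWithin (q+1) w (Set.Ioo a b) with hg
  have hgc : ContinuousOn g (Set.Ioo a b) :=
    hw.continuousOn_iteratedDerivWithin le_rfl (uniqueDiffOn_Ioo a b)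
  obtain ⟨hgi, hCS⟩ := aux_CS a b hab g hgc hi
  have hL : 0 < b - a := by linarith
  have hsub : Set.uIcc x₀ x ⊆ Set.Ioo a b := Set.OrdConnected.uIcc_subset inferInstance hx₀ hx
  by_cases hne : x₀ = x
  · subst hne
    rw [Fin.sum_univ_succ]
    simp
    positivity
  have hud := uniqueDiffOn_uIcc hne
  have hat : ∀ t ∈ Set.Ioo a b, ContDiffAt ℝ (q+1:ℕ) w t := fun t ht =>
    hw.contDiffAt (isOpen_Ioo.mem_nhds ht)
  have hT := taylor_integral_remainder (hw.mono hsub)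
  have e1 : taylorWithinEval w q (Set.uIcc x₀ x) x₀ x =
      ∑ j : Fin (q+1), iteratedDeriv j w x₀ / (Nat.factorial j : ℝ) * (x - x₀) ^ (j:ℕ) := by
    rw [taylor_within_apply, ← Fin.sum_univ_eq_sum_range (fun k => (((Nat.factorial k) : ℝ)⁻¹ * (x - x₀) ^ k) • iteratedDerivWithin k w (Set.uIcc x₀ x) x₀)]
    apply Finset.sum_congr rfl
    intro j _
    rw [iteratedDerivWithin_eq_iteratedDeriv hud ((hat x₀ hx₀).of_le (by norm_cast; omega)) Set.left_mem_uIcc]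
    simp only [smul_eq_mul]
    ring
  rw [← e1, hT, ← Real.norm_eq_abs]
  refine (intervalIntegral.norm_integral_le_integral_norm_uIoc).trans ?_
  have hsub' : Set.uIoc x₀ x ⊆ Set.Ioo a b := Set.uIoc_subset_uIcc.trans hsub
  have hI : IntegrableOn (fun t => (b-a)^q * |g t|) (Set.Ioo a b) := hgi.abs.const_mul _
  have step : ∫ t in Set.uIoc x₀ x, ‖((x - t) ^ q / (Nat.factorial q : ℝ)) • iteratedDerivWithin (q + 1) w (Set.uIcc x₀ x) t‖
      ≤ ∫ t in Set.uIoc x₀ x, (b-a)^q * |g t| := by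
    apply integral_mono_of_nonneg
    · filter_upwards with t; positivity
    · exact hI.mono_set hsub'
    · rw [Filter.EventuallyLE, ae_restrict_iff' measurableSet_uIoc]
      filter_upwards with t ht
      have ht' := hsub' ht
      rw [iteratedDerivWithin_eq_iteratedDeriv hud (hat t ht') (Set.uIoc_subset_uIcc ht),
        ← iteratedDerivWithin_eq_iteratedDeriv (uniqueDiffOn_Ioo a b) (hat t ht') ht', norm_smul]
      simp only [Real.norm_eq_abs]
      rw [← hg]
      gcongr
      rw [abs_div, abs_pow, Nat.abs_cast]
      have h1 : |x - t| ≤ b - a := by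
        rw [abs_le]; constructor <;> linarith [hx.1, hx.2, ht'.1, ht'.2]
      calc |x - t| ^ q / (Nat.factorial q : ℝ) ≤ |x - t| ^ q :=
            div_le_self (by positivity) (by exact_mod_cast Nat.one_le_iff_ne_zero.mpr (Nat.factorial_ne_zero q))
        _ ≤ _ := by gcongr
  refine step.trans ((setIntegral_mono_set hI (by filter_upwards with t; positivity) hsub'.eventuallyLE).trans ?_)
  rw [integral_const_mul]
  gcongr

lemma aux_integrable (n : ℕ) (a b : ℝ) (hab : a < b) (u v : ℝ → ℝ)
    (hv : ContDiffOn ℝ n v (Set.Icc a b))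
    (hu : ContDiffOn ℝ n u (Set.Ioo a b))
    (hi : ∀ k ≤ n, IntegrableOn (fun x => (iteratedDerivWithin k u (Set.Ioo a b) x) ^ 2) (Set.Ioo a b)) :
    IntegrableOn (fun x => (iteratedDerivWithin n (u * v) (Set.Ioo a b) x) ^ 2) (Set.Ioo a b) := by
  have hv' := hv.mono Set.Ioo_subset_Icc_self
  have hmem : ∀ k ≤ n, MemLp (iteratedDerivWithin k u (Set.Ioo a b)) 2 (volume.restrict (Set.Ioo a b)) := by
    intro k hk
    rw [memLp_two_iff_integrable_sq]
    · exact hi k hk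
    · exact (hu.continuousOn_iteratedDerivWithin (by exact_mod_cast hk) (uniqueDiffOn_Ioo a b)).aestronglyMeasurable measurableSet_Ioo
  have key : MemLp (fun x => ∑ i ∈ Finset.range (n + 1),
      (n.choose i : ℝ) * iteratedDerivWithin i u (Set.Ioo a b) x * iteratedDerivWithin (n - i) v (Set.Ioo a b) x) 2 (volume.restrict (Set.Ioo a b)) := by
    apply memLp_finsetSum
    intro i hir
    have hin : i ≤ n := by simpa [Nat.lt_succ_iff] using hir
    have hcv : ContinuousOn (iteratedDerivWithin (n-i) v (Set.Icc a b)) (Set.Icc a b) :=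
      hv.continuousOn_iteratedDerivWithin (by norm_cast; omega) (uniqueDiffOn_Icc hab)
    obtain ⟨B, hB⟩ := isCompact_Icc.exists_bound_of_continuousOn hcv
    have hcv' : ContinuousOn (iteratedDerivWithin (n-i) v (Set.Ioo a b)) (Set.Ioo a b) :=
      hv'.continuousOn_iteratedDerivWithin (by norm_cast; omega) (uniqueDiffOn_Ioo a b)
    have hcu : ContinuousOn (iteratedDerivWithin i u (Set.Ioo a b)) (Set.Ioo a b) :=
      hu.continuousOn_iteratedDerivWithin (by exact_mod_cast hin) (uniqueDiffOn_Ioo a b)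
    refine MemLp.of_le_mul (c := n.choose i * B) (hmem i hin) ?_ ?_
    · exact ((continuousOn_const.mul hcu).mul hcv').aestronglyMeasurable measurableSet_Ioo
    · rw [ae_restrict_iff' measurableSet_Ioo]
      filter_upwards with t ht
      have hat : ContDiffAt ℝ (n-i:ℕ) v t :=
        (hv'.contDiffAt (isOpen_Ioo.mem_nhds ht)).of_le (by norm_cast; omega)
      have hBt := hB t (Set.Ioo_subset_Icc_self ht)
      rw [iteratedDerivWithin_eq_iteratedDeriv (uniqueDiffOn_Icc hab) hat (Set.Ioo_subset_Icc_self ht),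
        ← iteratedDerivWithin_eq_iteratedDeriv (uniqueDiffOn_Ioo a b) hat ht] at hBt
      rw [norm_mul, norm_mul, Real.norm_natCast]
      calc _ ≤ (n.choose i : ℝ) * ‖iteratedDerivWithin i u (Set.Ioo a b) t‖ * B := by gcongr
        _ = _ := by ring
  have := key.integrable_sq
  refine IntegrableOn.congr_fun this ?_ measurableSet_Ioo
  intro t ht
  simp only
  rw [iteratedDerivWithin_mul ht (uniqueDiffOn_Ioo a b) (hu t ht) (hv' t ht)]

/-- Continuous and bounded on the open interval. -/
def AuxBC (a b : ℝ) (f : ℝ → ℝ) : Prop :=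
  ContinuousOn f (Set.Ioo a b) ∧ ∃ M, ∀ x ∈ Set.Ioo a b, |f x| ≤ M

lemma AuxBC.mul {a b : ℝ} {f g : ℝ → ℝ} (hf : AuxBC a b f) (hg : AuxBC a b g) :
    AuxBC a b (fun x => f x * g x) := by
  obtain ⟨hf, M, hM⟩ := hf
  obtain ⟨hg, N, hN⟩ := hg
  refine ⟨hf.mul hg, M * N, fun x hx => ?_⟩
  rw [abs_mul]
  exact mul_le_mul (hM x hx) (hN x hx) (abs_nonneg _) ((abs_nonneg _).trans (hM x hx))

lemma AuxBC.sub {a b : ℝ} {f g : ℝ → ℝ} (hf : AuxBC a b f) (hg : AuxBC a b g) :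
    AuxBC a b (fun x => f x - g x) := by
  obtain ⟨hf, M, hM⟩ := hf
  obtain ⟨hg, N, hN⟩ := hg
  refine ⟨hf.sub hg, M + N, fun x hx => ?_⟩
  exact (abs_sub _ _).trans (add_le_add (hM x hx) (hN x hx))

lemma AuxBC.of_Icc {a b : ℝ} {f : ℝ → ℝ} (hf : ContinuousOn f (Set.Icc a b)) : AuxBC a b f := by
  obtain ⟨B, hB⟩ := isCompact_Icc.exists_bound_of_continuousOn hf
  exact ⟨hf.mono Set.Ioo_subset_Icc_self, B, fun x hx => hB x (Set.Ioo_subset_Icc_self hx)⟩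

lemma AuxBC.integrableOn {a b : ℝ} {f : ℝ → ℝ} (hf : AuxBC a b f) :
    IntegrableOn f (Set.Ioo a b) := by
  obtain ⟨hf, M, hM⟩ := hf
  have hc : IntegrableOn (fun _ => M) (Set.Ioo a b) := by simp
  refine Integrable.mono' hc (hf.aestronglyMeasurable measurableSet_Ioo) ?_
  rw [ae_restrict_iff' measurableSet_Ioo]
  filter_upwards with t ht using hM t ht

/-- Local `L^∞` error estimate for the `L²(Ω_k)` orthogonal projection `P_h` onto the
multiplicative enriched basis `V_h^*` spanned by `x ↦ (x-x_k)^j u_θ(x)/j!`, `j = 0,…,q`,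
on the cell `Ω_k = (x_k - Δx_k/2, x_k + Δx_k/2)`.  The projection `P_h(u)` is characterized
as the element of the span that is `L²(Ω_k)`-orthogonal to the residual `u - P_h(u)`.
There is `C > 0`, depending only on `q`, such that
`‖u - P_h(u)‖_{L^∞(Ω_k)} ≤ C |u/u_θ|_{H^{q+1}(Ω_k)} Δx_k^{q+1/2}
   (1 + ‖u_θ²‖_{L^∞(Ω_k)}/m²) ‖u_θ‖_{L^∞(Ω_k)}`
whenever `u_θ ∈ C^{q+1}` on the closed cell with `u_θ² > m² > 0` and `u ∈ H^{q+1}(Ω_k)`. -/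
theorem multiplicative_projection_Linfty_error (q : ℕ) :
    ∃ C : ℝ, 0 < C ∧
      ∀ (xk Δx : ℝ), 0 < Δx →
      ∀ (m : ℝ), 0 < m →
      ∀ uθ : ℝ → ℝ,
        ContDiffOn ℝ (q + 1 : ℕ) uθ (Set.Icc (xk - Δx / 2) (xk + Δx / 2)) →
        (∀ x ∈ Set.Ioo (xk - Δx / 2) (xk + Δx / 2), m ^ 2 < uθ x ^ 2) →
      ∀ u : ℝ → ℝ,
        ContDiffOn ℝ (q + 1 : ℕ) u (Set.Ioo (xk - Δx / 2) (xk + Δx / 2)) →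
        (∀ k ≤ q + 1,
          IntegrableOn
            (fun x => (iteratedDerivWithin k u (Set.Ioo (xk - Δx / 2) (xk + Δx / 2)) x) ^ 2)
            (Set.Ioo (xk - Δx / 2) (xk + Δx / 2))) →
      ∀ Ph : ℝ → ℝ,
        (∃ c : Fin (q + 1) → ℝ, ∀ x, Ph x =
            ∑ j : Fin (q + 1), c j *
              ((x - xk) ^ (j : ℕ) * uθ x / (Nat.factorial (j : ℕ) : ℝ))) →
        (∀ j : Fin (q + 1),
          ∫ x in Set.Ioo (xk - Δx / 2) (xk + Δx / 2),
            (u x - Ph x) * ((x - xk) ^ (j : ℕ) * uθ x / (Nat.factorial (j : ℕ) : ℝ)) = 0) →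
      ∀ x ∈ Set.Ioo (xk - Δx / 2) (xk + Δx / 2),
        |u x - Ph x| ≤
          C * Real.sqrt (∫ y in Set.Ioo (xk - Δx / 2) (xk + Δx / 2),
                (iteratedDerivWithin (q + 1) (fun z => u z / uθ z)
                    (Set.Ioo (xk - Δx / 2) (xk + Δx / 2)) y) ^ 2) *
            Δx ^ ((q : ℝ) + 1 / 2) *
            (1 + sSup ((fun y => |uθ y ^ 2|) '' Set.Ioo (xk - Δx / 2) (xk + Δx / 2)) / m ^ 2) *
            sSup ((fun y => |uθ y|) '' Set.Ioo (xk - Δx / 2) (xk + Δx / 2)) := by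
  obtain ⟨K, hK0, hK⟩ := aux_inverse q
  refine ⟨1 + √K, by positivity, ?_⟩
  intro xk Δx hΔ m hm v hv hvm u hu hui Ph hPh horth x hx
  obtain ⟨c, hc⟩ := hPh
  have hab : xk - Δx / 2 < xk + Δx / 2 := by linarith
  have hba : (xk + Δx / 2) - (xk - Δx / 2) = Δx := by ring
  have hvIcc : ∀ y ∈ Set.Icc (xk - Δx / 2) (xk + Δx / 2), m ^ 2 ≤ v y ^ 2 := by
    intro y hy
    have hcl : closure (Set.Ioo (xk - Δx / 2) (xk + Δx / 2)) =
      Set.Icc (xk - Δx / 2) (xk + Δx / 2) := closure_Ioo hab.ne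
    refine ContinuousWithinAt.closure_le (s := Set.Ioo (xk - Δx / 2) (xk + Δx / 2))
      (f := fun _ => m ^ 2) (g := fun y => v y ^ 2) (by rw [hcl]; exact hy)
      continuousWithinAt_const ?_ (fun z hz => (hvm z hz).le)
    exact ((hv.continuousOn.pow 2) y hy).mono Set.Ioo_subset_Icc_self
  have hv0 : ∀ y ∈ Set.Icc (xk - Δx / 2) (xk + Δx / 2), v y ≠ 0 := by
    intro y hy h0
    have := hvIcc y hy
    rw [h0] at this
    have : 0 < m ^ 2 := by positivity
    linarith
  have hvinv : ContDiffOn ℝ (q + 1 : ℕ) (v⁻¹) (Set.Icc (xk - Δx / 2) (xk + Δx / 2)) :=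
    hv.inv hv0
  have hwe : (fun z => u z / v z) = u * v⁻¹ := by
    funext z; simp [div_eq_mul_inv]
  have hwi := aux_integrable (q+1) _ _ hab u v⁻¹ hvinv hu hui
  have hwc : ContDiffOn ℝ (q + 1 : ℕ) (u * v⁻¹) (Set.Ioo (xk - Δx / 2) (xk + Δx / 2)) :=
    hu.mul (hvinv.mono Set.Ioo_subset_Icc_self)
  rw [hwe]
  set w := u * v⁻¹ with hw
  have hxk : xk ∈ Set.Ioo (xk - Δx / 2) (xk + Δx / 2) := by constructor <;> linarith
  have hT := fun y hy => aux_taylor q _ _ hab w hwc hwi xk y hxk hy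
  rw [hba] at hT
  set I := ∫ y in Set.Ioo (xk - Δx / 2) (xk + Δx / 2),
    (iteratedDerivWithin (q + 1) w (Set.Ioo (xk - Δx / 2) (xk + Δx / 2)) y) ^ 2 with hI
  set B := Δx ^ q * (√Δx * √I) with hB
  have hB0 : 0 ≤ B := by positivity
  let d : Fin (q+1) → ℝ := fun j => iteratedDeriv j w xk
  let R : ℝ → ℝ := fun y => w y - ∑ j : Fin (q+1), d j / (Nat.factorial j : ℝ) * (y - xk) ^ (j:ℕ)
  let a : Fin (q+1) → ℝ := fun j => (c j - d j) / (Nat.factorial j : ℝ)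
  let r : ℝ → ℝ := fun y => ∑ j : Fin (q+1), a j * (y - xk) ^ (j:ℕ)
  have hR : ∀ y ∈ Set.Ioo (xk - Δx / 2) (xk + Δx / 2), |R y| ≤ B := hT
  have hrcont : Continuous r := by fun_prop
  have hRcont : ContinuousOn R (Set.Ioo (xk - Δx / 2) (xk + Δx / 2)) := by
    apply hwc.continuousOn.sub
    fun_prop
  have bR : AuxBC (xk - Δx / 2) (xk + Δx / 2) R := ⟨hRcont, B, hR⟩
  have br : AuxBC (xk - Δx / 2) (xk + Δx / 2) r := AuxBC.of_Icc hrcont.continuousOn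
  have bv : AuxBC (xk - Δx / 2) (xk + Δx / 2) v := AuxBC.of_Icc hv.continuousOn
  have hres : ∀ y ∈ Set.Ioo (xk - Δx / 2) (xk + Δx / 2), u y - Ph y = v y * (R y - r y) := by
    intro y hy
    have hvy := hv0 y (Set.Ioo_subset_Icc_self hy)
    have e2 : R y - r y = w y - ∑ j : Fin (q+1), c j / (Nat.factorial j : ℝ) * (y - xk) ^ (j:ℕ) := by
      simp only [R, r, a]
      rw [sub_sub, ← Finset.sum_add_distrib]
      congr 1
      apply Finset.sum_congr rfl
      intro j _
      ring
    rw [e2, mul_sub, hc y, Finset.mul_sum]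
    congr 1
    · simp only [hw, Pi.mul_apply, Pi.inv_apply]
      field_simp
    · apply Finset.sum_congr rfl
      intro j _
      ring
  have horth' : ∫ y in Set.Ioo (xk - Δx / 2) (xk + Δx / 2), (v y * (R y - r y)) * (v y * r y) = 0 := by
    have e3 : ∫ y in Set.Ioo (xk - Δx / 2) (xk + Δx / 2), (v y * (R y - r y)) * (v y * r y) =
        ∫ y in Set.Ioo (xk - Δx / 2) (xk + Δx / 2), ∑ j : Fin (q+1), (a j * (Nat.factorial j : ℝ)) *
          ((v y * (R y - r y)) * ((y - xk) ^ (j : ℕ) * v y / (Nat.factorial (j : ℕ) : ℝ))) := by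
      congr 1
      funext y
      simp only [r]
      conv_lhs => rw [Finset.mul_sum, Finset.mul_sum]
      apply Finset.sum_congr rfl
      intro j _
      have : (Nat.factorial (j:ℕ) : ℝ) ≠ 0 := by exact_mod_cast Nat.factorial_ne_zero _
      field_simp
    rw [e3, integral_finsetSum]
    · apply Finset.sum_eq_zero
      intro j _
      rw [integral_const_mul]
      have : ∫ y in Set.Ioo (xk - Δx / 2) (xk + Δx / 2),
          ((v y * (R y - r y)) * ((y - xk) ^ (j : ℕ) * v y / (Nat.factorial (j : ℕ) : ℝ))) = 0 := by
        rw [← horth j]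
        apply setIntegral_congr_fun measurableSet_Ioo
        intro y hy
        simp only
        rw [hres y hy]
      rw [this, mul_zero]
    · intro j _
      apply Integrable.const_mul
      refine ((bv.mul (bR.sub br)).mul (AuxBC.of_Icc ?_)).integrableOn
      have := hv.continuousOn
      fun_prop
  have bvol : volume.real (Set.Ioo (xk - Δx / 2) (xk + Δx / 2)) = Δx := by
    rw [Real.volume_real_Ioo_of_le hab.le]; ring
  set S2 := sSup ((fun y => |v y ^ 2|) '' Set.Ioo (xk - Δx / 2) (xk + Δx / 2)) with hS2
  set S1 := sSup ((fun y => |v y|) '' Set.Ioo (xk - Δx / 2) (xk + Δx / 2)) with hS1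
  have hv1 : ∀ y ∈ Set.Ioo (xk - Δx / 2) (xk + Δx / 2), |v y| ≤ S1 := by
    intro y hy
    apply le_csSup
    · obtain ⟨-, M, hM⟩ := bv
      refine ⟨M, ?_⟩
      rintro _ ⟨z, hz, rfl⟩
      exact hM z hz
    · exact ⟨y, hy, rfl⟩
  have hv2 : ∀ y ∈ Set.Ioo (xk - Δx / 2) (xk + Δx / 2), v y ^ 2 ≤ S2 := by
    intro y hy
    refine (le_abs_self _).trans ?_
    apply le_csSup
    · obtain ⟨-, M, hM⟩ := bv.mul bv
      refine ⟨M, ?_⟩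
      rintro _ ⟨z, hz, rfl⟩
      simpa only [sq] using hM z hz
    · exact ⟨y, hy, rfl⟩
  have hm2 : 0 < m ^ 2 := by positivity
  have hN : 1 ≤ S2 / m ^ 2 := by
    rw [one_le_div hm2]
    exact (hvm xk hxk).le.trans (hv2 xk hxk)
  have bvr := bv.mul br
  have bvR := bv.mul bR
  have i1 : m ^ 2 * ∫ y in Set.Ioo (xk - Δx / 2) (xk + Δx / 2), r y ^ 2 ≤
      ∫ y in Set.Ioo (xk - Δx / 2) (xk + Δx / 2), (v y * r y) * (v y * r y) := by
    rw [← integral_const_mul]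
    apply setIntegral_mono_on _ (bvr.mul bvr).integrableOn measurableSet_Ioo
    · intro y hy
      have := hvm y hy
      nlinarith [sq_nonneg (r y)]
    · have := (br.mul br).integrableOn
      simp only [← sq] at this
      exact this.const_mul _
  have i2 : ∫ y in Set.Ioo (xk - Δx / 2) (xk + Δx / 2), (v y * r y) * (v y * r y) ≤
      ∫ y in Set.Ioo (xk - Δx / 2) (xk + Δx / 2), (v y * R y) * (v y * R y) := by
    have hint := ((bv.mul (bR.sub br)).mul bvr).integrableOn
    have : ∫ y in Set.Ioo (xk - Δx / 2) (xk + Δx / 2), ((v y * r y) * (v y * r y) +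
        2 * ((v y * (R y - r y)) * (v y * r y))) ≤
        ∫ y in Set.Ioo (xk - Δx / 2) (xk + Δx / 2), (v y * R y) * (v y * R y) := by
      apply integral_mono
      · exact (bvr.mul bvr).integrableOn.add (hint.const_mul 2)
      · exact (bvR.mul bvR).integrableOn
      · intro y
        simp only
        nlinarith [sq_nonneg (v y * (R y - r y))]
    rw [integral_add (bvr.mul bvr).integrableOn (hint.const_mul 2), integral_const_mul, horth'] at this
    linarith
  have i3 : ∫ y in Set.Ioo (xk - Δx / 2) (xk + Δx / 2), (v y * R y) * (v y * R y) ≤ Δx * (S2 * B ^ 2) := by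
    calc _ ≤ ∫ y in Set.Ioo (xk - Δx / 2) (xk + Δx / 2), S2 * B ^ 2 := by
          apply setIntegral_mono_on (bvR.mul bvR).integrableOn (integrableOn_const (by simp)) measurableSet_Ioo
          intro y hy
          have h1 := hv2 y hy
          have h2 : R y ^ 2 ≤ B ^ 2 := by
            rw [← sq_abs (R y)]
            have := hR y hy
            gcongr
          calc v y * R y * (v y * R y) = v y ^ 2 * R y ^ 2 := by ring
            _ ≤ S2 * B ^ 2 := by gcongr; exact (sq_nonneg _).trans h1
      _ = _ := by rw [setIntegral_const, bvol, smul_eq_mul]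
  have i4 : r x ^ 2 * Δx ≤ K * ∫ y in Set.Ioo (xk - Δx / 2) (xk + Δx / 2), r y ^ 2 :=
    aux_scaled q K hK a xk Δx hΔ x hx
  set N := S2 / m ^ 2 with hNdef
  have hS2N : S2 = N * m ^ 2 := by rw [hNdef]; field_simp
  have i5 : r x ^ 2 ≤ K * (N * B ^ 2) := by
    have hJ : (∫ y in Set.Ioo (xk - Δx / 2) (xk + Δx / 2), r y ^ 2) ≤ Δx * (N * B ^ 2) := by
      have := i1.trans (i2.trans i3)
      rw [hS2N] at this
      refine le_of_mul_le_mul_left (this.trans_eq ?_) hm2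
      ring
    refine le_of_mul_le_mul_right (i4.trans ?_) hΔ
    calc _ ≤ K * (Δx * (N * B ^ 2)) := by gcongr
      _ = _ := by ring
  have i6 : |r x| ≤ √K * (N * B) := by
    apply abs_le_of_sq_le_sq _ (by positivity)
    rw [mul_pow, Real.sq_sqrt hK0.le, mul_pow]
    refine i5.trans ?_
    gcongr
    nlinarith
  have hfin : |R x - r x| ≤ (1 + √K) * B * (1 + N) := by
    have h1 := abs_sub (R x) (r x)
    have h2 := hR x hx
    have h3 : 0 ≤ √K * B := by positivity
    have h4 : 0 ≤ B * N := by positivity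
    nlinarith
  have hS1 : 0 ≤ S1 := (abs_nonneg _).trans (hv1 x hx)
  have hpow : Δx ^ ((q:ℝ) + 1/2) = Δx ^ q * √Δx := by
    rw [Real.rpow_add hΔ, Real.rpow_natCast, Real.sqrt_eq_rpow]
  rw [hres x hx, abs_mul, hpow]
  calc |v x| * |R x - r x| ≤ S1 * ((1 + √K) * B * (1 + N)) := by
        gcongr
        exact hv1 x hx
    _ = _ := by rw [hB]; ring
end

section
/- Fix q ∈ ℕ. There exists a constant C > 0 depending only on q with the following property. Let Ω_k = (x_k − Δx_k/2, x_k + Δx_k/2) be a cell with center x_k and length Δx_k > 0, let m > 0, and let u_θ be of class C^{q+1} on the closure of Ω_k with u_θ(x)² > m² for all x ∈ Ω_k. Let P_h be the orthogonal projection of L²(Ω_k) onto the span of the functions x ↦ (x − x_k)^j u_θ(x)/j!, j = 0,…,q, and let T_θ(u)(x) = (Σ_{j=0}^q (u/u_θ)^{(j)}(x_k) (x − x_k)^j / j!) · u_θ(x). Then for every u ∈ H^{q+1}(Ω_k), ‖T_θ(u) − P_h(u)‖_{L∞(Ω_k)} ≤ C |u/u_θ|_{H^{q+1}(Ω_k)}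 (Δx_k)^{q+1/2} (‖u_θ²‖_{L∞(Ω_k)}/m²) ‖u_θ‖_{L∞(Ω_k)}. -/
open MeasureTheory

lemma poly_norm_bound (q : ℕ) : ∃ c : ℝ, 0 < c ∧ ∀ a : Fin (q + 1) → ℝ,
    c * ‖a‖ ^ 2 ≤ ∫ y in (-1/2 : ℝ)..(1/2), (∑ j : Fin (q + 1), a j * y ^ (j : ℕ)) ^ 2 := by
  set F : (Fin (q + 1) → ℝ) → ℝ := fun a =>
    ∫ y in (-1/2 : ℝ)..(1/2), (∑ j : Fin (q + 1), a j * y ^ (j : ℕ)) ^ 2 with hF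
  have hcont : Continuous F := by
    apply intervalIntegral.continuous_parametric_intervalIntegral_of_continuous'
    unfold Function.uncurry
    fun_prop
  have hpos : ∀ a, a ≠ 0 → 0 < F a := by
    intro a ha
    have hc : Continuous fun y : ℝ => (∑ j : Fin (q + 1), a j * y ^ (j : ℕ)) ^ 2 := by fun_prop
    by_contra hneg
    apply ha
    have hz : ∀ y ∈ Set.Icc (-1/2 : ℝ) (1/2), (∑ j : Fin (q + 1), a j * y ^ (j : ℕ)) ^ 2 = 0 := by
      by_contra hne
      push Not at hne
      obtain ⟨y, hy, hy0⟩ := hne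
      apply hneg
      apply intervalIntegral.integral_pos (by norm_num) hc.continuousOn
      · intro x _; positivity
      · exact ⟨y, hy, lt_of_le_of_ne (sq_nonneg _) (Ne.symm hy0)⟩
    set P : Polynomial ℝ := ∑ j : Fin (q + 1), Polynomial.C (a j) * Polynomial.X ^ (j : ℕ) with hP
    have hP0 : P = 0 := by
      apply Polynomial.eq_zero_of_infinite_isRoot
      apply Set.Infinite.mono _ (Set.Icc_infinite (show (-1/2 : ℝ) < 1/2 by norm_num))
      intro y hy
      have := hz y hy
      simp only [Set.mem_ofPred_eq, Polynomial.IsRoot, hP, Polynomial.eval_finsetSum]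
      simpa using this
    funext i
    have := congrArg (fun p => Polynomial.coeff p (i : ℕ)) hP0
    simp only [hP, Polynomial.finsetSum_coeff, Polynomial.coeff_C_mul_X_pow,
      Polynomial.coeff_zero] at this
    rw [Finset.sum_eq_single i] at this
    · simpa using this
    · intro b _ hb
      rw [if_neg]
      intro h; exact hb (Fin.ext h.symm)
    · simp
  have hne : (Metric.sphere (0 : Fin (q + 1) → ℝ) 1).Nonempty :=
    NormedSpace.sphere_nonempty.mpr zero_le_one
  obtain ⟨a0, ha0, hmin⟩ := (isCompact_sphere (0 : Fin (q + 1) → ℝ) 1).exists_isMinOn hne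
    hcont.continuousOn
  have ha0n : a0 ≠ 0 := by
    rintro rfl
    simp at ha0
  refine ⟨F a0, hpos a0 ha0n, fun a => ?_⟩
  by_cases ha : a = 0
  · subst ha; simp
  have hna : ‖a‖ ≠ 0 := norm_ne_zero_iff.mpr ha
  have h1 : F a0 ≤ F (‖a‖⁻¹ • a) := hmin (by simp [norm_smul, hna])
  have h2 : F (‖a‖⁻¹ • a) = (‖a‖⁻¹) ^ 2 * F a := by
    simp only [hF]
    rw [← intervalIntegral.integral_const_mul]
    congr 1
    funext y
    rw [← mul_pow, Finset.mul_sum]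
    congr 2
    funext j
    simp [mul_assoc]
  rw [h2] at h1
  calc F a0 * ‖a‖ ^ 2 ≤ ((‖a‖⁻¹) ^ 2 * F a) * ‖a‖ ^ 2 := by gcongr
    _ = F a := by field_simp

lemma poly_sup_bound (q : ℕ) : ∃ c : ℝ, 0 < c ∧ ∀ (xk Δx : ℝ), 0 < Δx →
    ∀ b : Fin (q + 1) → ℝ, ∀ x ∈ Set.Icc (xk - Δx / 2) (xk + Δx / 2),
    c * Δx * (∑ j : Fin (q + 1), b j * (x - xk) ^ (j : ℕ)) ^ 2 ≤
      ∫ y in Set.Ioo (xk - Δx / 2) (xk + Δx / 2),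
        (∑ j : Fin (q + 1), b j * (y - xk) ^ (j : ℕ)) ^ 2 := by
  obtain ⟨c, hc, H⟩ := poly_norm_bound q
  refine ⟨c / ((q : ℝ) + 1) ^ 2, by positivity, fun xk Δx hΔ b x hx => ?_⟩
  set a : Fin (q + 1) → ℝ := fun j => b j * Δx ^ (j : ℕ) with ha
  have h1 : ∫ y in Set.Ioo (xk - Δx / 2) (xk + Δx / 2),
        (∑ j : Fin (q + 1), b j * (y - xk) ^ (j : ℕ)) ^ 2 =
      Δx * ∫ y in (-1/2 : ℝ)..(1/2), (∑ j : Fin (q + 1), a j * y ^ (j : ℕ)) ^ 2 := by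
    rw [← integral_Ioc_eq_integral_Ioo, ← intervalIntegral.integral_of_le (by linarith)]
    have := intervalIntegral.smul_integral_comp_add_mul (a := -1/2) (b := 1/2)
      (fun y => (∑ j : Fin (q + 1), b j * (y - xk) ^ (j : ℕ)) ^ 2) Δx xk
    rw [show xk - Δx / 2 = xk + Δx * (-1/2) by ring, show xk + Δx / 2 = xk + Δx * (1/2) by ring,
      ← this, smul_eq_mul]
    congr 2
    funext y
    congr 2
    funext j
    simp only [ha, add_sub_cancel_left, mul_pow]
    ring
  have h2 : |∑ j : Fin (q + 1), b j * (x - xk) ^ (j : ℕ)| ≤ ((q : ℝ) + 1) * ‖a‖ := by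
    calc _ ≤ ∑ j : Fin (q + 1), |b j * (x - xk) ^ (j : ℕ)| := Finset.abs_sum_le_sum_abs _ _
      _ ≤ ∑ j : Fin (q + 1), ‖a‖ := by
        apply Finset.sum_le_sum
        intro j _
        refine le_trans ?_ (norm_le_pi_norm a j)
        simp only [ha, Real.norm_eq_abs, abs_mul, abs_pow]
        have hle : |x - xk| ≤ |Δx| := by
          rw [abs_of_pos hΔ, abs_le]
          constructor <;> linarith [hx.1, hx.2]
        exact mul_le_mul_of_nonneg_left (pow_le_pow_left₀ (abs_nonneg _) hle _) (abs_nonneg _)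
      _ = _ := by simp
  rw [h1]
  have h3 : (∑ j : Fin (q + 1), b j * (x - xk) ^ (j : ℕ)) ^ 2 ≤ (((q : ℝ) + 1) * ‖a‖) ^ 2 := by
    rw [← sq_abs]; gcongr
  calc _ ≤ c / ((q : ℝ) + 1) ^ 2 * Δx * (((q : ℝ) + 1) * ‖a‖) ^ 2 := by gcongr
    _ = Δx * (c * ‖a‖ ^ 2) := by field_simp
    _ ≤ _ := by gcongr; exact H a

lemma cs_bound {a b : ℝ} (hab : a ≤ b) {f : ℝ → ℝ} (hf : ContinuousOn f (Set.Ioo a b))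
    (h2 : IntegrableOn (fun x => f x ^ 2) (Set.Ioo a b)) :
    IntegrableOn f (Set.Ioo a b) ∧
    ∫ x in Set.Ioo a b, |f x| ≤
      Real.sqrt (b - a) * Real.sqrt (∫ x in Set.Ioo a b, f x ^ 2) := by
  have hm : AEStronglyMeasurable f (volume.restrict (Set.Ioo a b)) :=
    hf.aestronglyMeasurable measurableSet_Ioo
  have hL : MemLp f 2 (volume.restrict (Set.Ioo a b)) := (memLp_two_iff_integrable_sq hm).2 h2
  refine ⟨hL.integrable (by norm_num), ?_⟩
  have := integral_mul_le_Lp_mul_Lq_of_nonneg (μ := volume.restrict (Set.Ioo a b))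
    Real.HolderConjugate.two_two (f := fun _ => 1) (g := fun x => |f x|)
    (Filter.Eventually.of_forall fun _ => zero_le_one)
    (Filter.Eventually.of_forall fun _ => abs_nonneg _) (memLp_const 1)
    (by rw [ENNReal.ofReal_ofNat]; exact hL.abs)
  simp only [one_mul, Real.rpow_two, sq_abs, ← Real.sqrt_eq_rpow] at this
  refine this.trans (le_of_eq ?_)
  congr 2
  simp [hab]

lemma taylor_bound (q : ℕ) {xk Δx : ℝ} (hΔ : 0 < Δx) {g : ℝ → ℝ}
    (hg : ContDiffOn ℝ (q + 1 : ℕ) g (Set.Ioo (xk - Δx / 2) (xk + Δx / 2)))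
    (h2 : IntegrableOn (fun x => (iteratedDerivWithin (q + 1) g
      (Set.Ioo (xk - Δx / 2) (xk + Δx / 2)) x) ^ 2) (Set.Ioo (xk - Δx / 2) (xk + Δx / 2)))
    {x : ℝ} (hx : x ∈ Set.Ioo (xk - Δx / 2) (xk + Δx / 2)) :
    |taylorWithinEval g q (Set.Ioo (xk - Δx / 2) (xk + Δx / 2)) xk x - g x| ≤
      Real.sqrt (∫ y in Set.Ioo (xk - Δx / 2) (xk + Δx / 2),
        (iteratedDerivWithin (q + 1) g (Set.Ioo (xk - Δx / 2) (xk + Δx / 2)) y) ^ 2) *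
        Δx ^ ((q : ℝ) + 1 / 2) := by
  set s := Set.Ioo (xk - Δx / 2) (xk + Δx / 2) with hs
  have hxk : xk ∈ s := ⟨by linarith, by linarith⟩
  have hsub : Set.uIcc xk x ⊆ s := Set.ordConnected_Ioo.uIcc_subset hxk hx
  have hcont := hg.continuousOn_iteratedDerivWithin (m := q + 1) le_rfl (uniqueDiffOn_Ioo _ _)
  have hder : ∀ t ∈ Set.uIcc xk x, HasDerivAt (fun t => taylorWithinEval g q s t x)
      (((q.factorial : ℝ)⁻¹ * (x - t) ^ q) • iteratedDerivWithin (q + 1) g s t) t := by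
    intro t ht
    have hts := hsub ht
    refine (hasDerivWithinAt_taylorWithinEval (uniqueDiffOn_Ioo _ _) self_mem_nhdsWithin hts
      subset_rfl (hg.of_le (by norm_cast; omega)) ?_).hasDerivAt (isOpen_Ioo.mem_nhds hts)
    exact hg.differentiableOn_iteratedDerivWithin (by norm_cast; omega) (uniqueDiffOn_Ioo _ _) t hts
  have hci : ContinuousOn (fun t => ((q.factorial : ℝ)⁻¹ * (x - t) ^ q) •
      iteratedDerivWithin (q + 1) g s t) (Set.uIcc xk x) := by
    have h0 : ContinuousOn (fun t => (q.factorial : ℝ)⁻¹ * (x - t) ^ q) (Set.uIcc xk x) := by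
      fun_prop
    exact h0.smul (hcont.mono hsub)
  have hftc := intervalIntegral.integral_eq_sub_of_hasDerivAt hder hci.intervalIntegrable
  simp only [taylorWithinEval_self] at hftc
  rw [abs_sub_comm, ← hftc]
  obtain ⟨hint, hcs⟩ := cs_bound (by linarith) hcont h2
  have hsub' : Set.uIoc xk x ⊆ s := Set.uIoc_subset_uIcc.trans hsub
  calc _ ≤ ∫ t in Set.uIoc xk x, ‖((q.factorial : ℝ)⁻¹ * (x - t) ^ q) •
      iteratedDerivWithin (q + 1) g s t‖ := by
        rw [← Real.norm_eq_abs]; exact intervalIntegral.norm_integral_le_integral_norm_uIoc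
    _ ≤ ∫ t in Set.uIoc xk x, Δx ^ q * |iteratedDerivWithin (q + 1) g s t| := by
        apply setIntegral_mono_on
        · exact (hci.norm.integrableOn_compact isCompact_uIcc).mono_set Set.uIoc_subset_uIcc
        · exact ((hint.mono_set hsub').abs).const_mul _
        · exact measurableSet_uIoc
        · intro t ht
          have hts := hsub' ht
          rw [norm_smul, Real.norm_eq_abs, Real.norm_eq_abs, abs_mul, abs_pow]
          have h1 : |((q.factorial : ℝ))⁻¹| ≤ 1 := by
            rw [abs_of_nonneg (by positivity)]
            apply inv_le_one_of_one_le₀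
            exact_mod_cast Nat.factorial_pos q
          have h3 : |x - t| ≤ Δx := by
            rw [abs_le]; constructor <;> linarith [hx.1, hx.2, hts.1, hts.2]
          calc _ ≤ 1 * Δx ^ q * |iteratedDerivWithin (q + 1) g s t| := by gcongr
            _ = _ := by ring
    _ ≤ ∫ t in s, Δx ^ q * |iteratedDerivWithin (q + 1) g s t| := by
        apply setIntegral_mono_set (hint.abs.const_mul _)
        · exact Filter.Eventually.of_forall fun t => by positivity
        · exact hsub'.eventuallyLE
    _ = Δx ^ q * ∫ t in s, |iteratedDerivWithin (q + 1) g s t| := integral_const_mul _ _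
    _ ≤ Δx ^ q * (Real.sqrt (xk + Δx / 2 - (xk - Δx / 2)) * Real.sqrt (∫ x in s,
        iteratedDerivWithin (q + 1) g s x ^ 2)) := by gcongr
    _ = _ := by
        rw [show xk + Δx / 2 - (xk - Δx / 2) = Δx by ring, Real.rpow_add hΔ, Real.rpow_natCast,
          ← Real.sqrt_eq_rpow]
        ring

lemma quot_integrable (q : ℕ) {a b : ℝ} (hab : a < b) {u v : ℝ → ℝ}
    (hv : ContDiffOn ℝ (q + 1 : ℕ) v (Set.Icc a b)) (hv0 : ∀ x ∈ Set.Icc a b, v x ≠ 0)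
    (hu : ContDiffOn ℝ (q + 1 : ℕ) u (Set.Ioo a b))
    (hint : ∀ k ≤ q + 1, IntegrableOn
      (fun x => (iteratedDerivWithin k u (Set.Ioo a b) x) ^ 2) (Set.Ioo a b)) :
    IntegrableOn (fun x => (iteratedDerivWithin (q + 1) (fun z => u z / v z)
      (Set.Ioo a b) x) ^ 2) (Set.Ioo a b) := by
  have hw : ContDiffOn ℝ (q + 1 : ℕ) (fun z => (v z)⁻¹) (Set.Icc a b) := hv.inv hv0
  have hw' := hw.mono Set.Ioo_subset_Icc_self
  have hg : ContDiffOn ℝ (q + 1 : ℕ) (fun z => u z / v z) (Set.Ioo a b) := by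
    simpa only [div_eq_mul_inv] using hu.mul hw'
  have hmeas : ∀ {f : ℝ → ℝ}, ContDiffOn ℝ (q + 1 : ℕ) f (Set.Ioo a b) → ∀ k ≤ q + 1,
      AEStronglyMeasurable (iteratedDerivWithin k f (Set.Ioo a b))
        (volume.restrict (Set.Ioo a b)) := by
    intro f hf k hk
    exact (hf.continuousOn_iteratedDerivWithin (by exact_mod_cast hk)
      (uniqueDiffOn_Ioo _ _)).aestronglyMeasurable measurableSet_Ioo
  refine (memLp_two_iff_integrable_sq (hmeas hg _ le_rfl)).1 ?_
  have key : MemLp (fun x => ∑ i ∈ Finset.range (q + 1 + 1),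
      ((q + 1).choose i : ℝ) * iteratedDerivWithin i u (Set.Ioo a b) x *
        iteratedDerivWithin (q + 1 - i) (fun z => (v z)⁻¹) (Set.Ioo a b) x) 2
      (volume.restrict (Set.Ioo a b)) := by
    apply memLp_finsetSum
    intro i hi
    have hi' : i ≤ q + 1 := by have := Finset.mem_range.1 hi; omega
    have hL : MemLp (iteratedDerivWithin i u (Set.Ioo a b)) 2 (volume.restrict (Set.Ioo a b)) :=
      (memLp_two_iff_integrable_sq (hmeas hu _ hi')).2 (hint i hi')
    obtain ⟨B, hB⟩ := isCompact_Icc.exists_bound_of_continuousOn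
      (hw.continuousOn_iteratedDerivWithin (m := q + 1 - i) (by norm_cast; omega)
        (uniqueDiffOn_Icc hab))
    refine MemLp.of_le_mul (c := ((q + 1).choose i : ℝ) * B) hL ?_ ?_
    · exact ((hmeas hu i hi').const_mul _).mul (hmeas hw' _ (by omega))
    · refine (ae_restrict_iff' measurableSet_Ioo).2 (Filter.Eventually.of_forall fun x hx => ?_)
      have he : iteratedDerivWithin (q + 1 - i) (fun z => (v z)⁻¹) (Set.Ioo a b) x =
          iteratedDerivWithin (q + 1 - i) (fun z => (v z)⁻¹) (Set.Icc a b) x := by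
        unfold iteratedDerivWithin
        rw [iteratedFDerivWithin_congr_set]
        filter_upwards [isOpen_Ioo.mem_nhds hx] with y hy
        exact propext ⟨fun h => Set.Ioo_subset_Icc_self h, fun _ => hy⟩
      have := hB x (Set.Ioo_subset_Icc_self hx)
      rw [norm_mul, norm_mul, he, Real.norm_natCast]
      calc _ ≤ ((q + 1).choose i : ℝ) * ‖iteratedDerivWithin i u (Set.Ioo a b) x‖ * B := by gcongr
        _ = _ := by ring
  refine key.ae_eq ?_
  refine (ae_restrict_iff' measurableSet_Ioo).2 (Filter.Eventually.of_forall fun x hx => ?_)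
  have := iteratedDerivWithin_mul (n := q + 1) hx (uniqueDiffOn_Ioo a b) (hu x hx) (hw' x hx)
  refine this.symm.trans ?_
  congr 1

/-- The `N₂` bound: there is `C > 0`, depending only on `q`, such that on every cell
`Ω_k = (x_k - Δx_k/2, x_k + Δx_k/2)`, with `u_θ ∈ C^{q+1}` on the closed cell satisfying
`u_θ² > m² > 0`, with `P_h` the `L²(Ω_k)` orthogonal projection onto the span of
`x ↦ (x-x_k)^j u_θ(x)/j!` (characterized by membership in the span and orthogonality of
the residual), and with the prior Taylor operator
`T_θ(u)(x) = (∑_{j=0}^q (u/u_θ)^{(j)}(x_k)(x-x_k)^j/j!) u_θ(x)`, every `u ∈ H^{q+1}(Ω_k)`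
satisfies `‖T_θ(u) - P_h(u)‖_{L^∞(Ω_k)} ≤ C |u/u_θ|_{H^{q+1}(Ω_k)} Δx_k^{q+1/2}
(‖u_θ²‖_{L^∞(Ω_k)}/m²) ‖u_θ‖_{L^∞(Ω_k)}`. -/
theorem prior_taylor_minus_projection_bound (q : ℕ) :
    ∃ C : ℝ, 0 < C ∧
      ∀ (xk Δx : ℝ), 0 < Δx →
      ∀ (m : ℝ), 0 < m →
      ∀ uθ : ℝ → ℝ,
        ContDiffOn ℝ (q + 1 : ℕ) uθ (Set.Icc (xk - Δx / 2) (xk + Δx / 2)) →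
        (∀ x ∈ Set.Ioo (xk - Δx / 2) (xk + Δx / 2), m ^ 2 < uθ x ^ 2) →
      ∀ u : ℝ → ℝ,
        ContDiffOn ℝ (q + 1 : ℕ) u (Set.Ioo (xk - Δx / 2) (xk + Δx / 2)) →
        (∀ k ≤ q + 1,
          IntegrableOn
            (fun x => (iteratedDerivWithin k u (Set.Ioo (xk - Δx / 2) (xk + Δx / 2)) x) ^ 2)
            (Set.Ioo (xk - Δx / 2) (xk + Δx / 2))) →
      ∀ Ph : ℝ → ℝ,
        (∃ c : Fin (q + 1) → ℝ, ∀ x, Ph x =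
            ∑ j : Fin (q + 1), c j *
              ((x - xk) ^ (j : ℕ) * uθ x / (Nat.factorial (j : ℕ) : ℝ))) →
        (∀ j : Fin (q + 1),
          ∫ x in Set.Ioo (xk - Δx / 2) (xk + Δx / 2),
            (u x - Ph x) * ((x - xk) ^ (j : ℕ) * uθ x / (Nat.factorial (j : ℕ) : ℝ)) = 0) →
      ∀ x ∈ Set.Ioo (xk - Δx / 2) (xk + Δx / 2),
        |(∑ j ∈ Finset.range (q + 1),
            iteratedDerivWithin j (fun z => u z / uθ z)
                (Set.Ioo (xk - Δx / 2) (xk + Δx / 2)) xk /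
              (Nat.factorial j : ℝ) * (x - xk) ^ j) * uθ x - Ph x| ≤
          C * Real.sqrt (∫ y in Set.Ioo (xk - Δx / 2) (xk + Δx / 2),
                (iteratedDerivWithin (q + 1) (fun z => u z / uθ z)
                    (Set.Ioo (xk - Δx / 2) (xk + Δx / 2)) y) ^ 2) *
            Δx ^ ((q : ℝ) + 1 / 2) *
            (sSup ((fun y => |uθ y ^ 2|) '' Set.Ioo (xk - Δx / 2) (xk + Δx / 2)) / m ^ 2) *
            sSup ((fun y => |uθ y|) '' Set.Ioo (xk - Δx / 2) (xk + Δx / 2)) := by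
  obtain ⟨c, hc, Hc⟩ := poly_sup_bound q
  refine ⟨1 / c, by positivity, ?_⟩
  intro xk Δx hΔ m hm v hv hvm u hu hui Ph hPh horth x hx
  obtain ⟨cc, hPh⟩ := hPh
  have hab : xk - Δx / 2 < xk + Δx / 2 := by linarith
  have hvc : ContinuousOn v (Set.Icc (xk - Δx / 2) (xk + Δx / 2)) := hv.continuousOn
  have hv0 : ∀ y ∈ Set.Icc (xk - Δx / 2) (xk + Δx / 2), v y ≠ 0 := by
    intro y hy h0
    have hcl : Set.Icc (xk - Δx / 2) (xk + Δx / 2) ⊆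
        closure (Set.Ioo (xk - Δx / 2) (xk + Δx / 2)) := by rw [closure_Ioo hab.ne]
    have h1 : m ^ 2 ≤ v y ^ 2 := by
      have hy' := hcl hy
      have hmem : v y ^ 2 ∈ closure ((fun z => v z ^ 2) ''
          Set.Ioo (xk - Δx / 2) (xk + Δx / 2)) :=
        ((hvc.mono (closure_Ioo hab.ne).subset).pow 2).image_closure ⟨y, hy', rfl⟩
      have hsub : closure ((fun z => v z ^ 2) '' Set.Ioo (xk - Δx / 2) (xk + Δx / 2)) ⊆
          Set.Ici (m ^ 2) := by
        apply closure_minimal _ isClosed_Ici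
        rintro _ ⟨z, hz, rfl⟩
        exact (hvm z hz).le
      exact hsub hmem
    rw [h0] at h1
    have : 0 < m ^ 2 := by positivity
    norm_num at h1
    linarith
  have hgi := quot_integrable q hab hv hv0 hu hui
  have hg : ContDiffOn ℝ (q + 1 : ℕ) (fun z => u z / v z)
      (Set.Ioo (xk - Δx / 2) (xk + Δx / 2)) :=
    hu.div (hv.mono Set.Ioo_subset_Icc_self) fun y hy => hv0 y (Set.Ioo_subset_Icc_self hy)
  have hT := fun y hy => taylor_bound q hΔ hg hgi (x := y) hy
  set s := Set.Ioo (xk - Δx / 2) (xk + Δx / 2) with hs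
  set g : ℝ → ℝ := fun z => u z / v z with hgdef
  set E : ℝ := Real.sqrt (∫ y in s, (iteratedDerivWithin (q + 1) g s y) ^ 2) *
    Δx ^ ((q : ℝ) + 1 / 2) with hE
  have hE0 : 0 ≤ E := by positivity
  set M := sSup ((fun y => |v y ^ 2|) '' s) with hMdef
  set N := sSup ((fun y => |v y|) '' s) with hNdef
  have hM : ∀ y ∈ s, v y ^ 2 ≤ M := by
    intro y hy
    refine (le_abs_self _).trans (le_csSup ?_ ⟨y, hy, rfl⟩)
    exact (isCompact_Icc.bddAbove_image (hvc.pow 2).abs).mono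
      (Set.image_mono Set.Ioo_subset_Icc_self)
  have hN : ∀ y ∈ s, |v y| ≤ N := by
    intro y hy
    refine le_csSup ?_ ⟨y, hy, rfl⟩
    exact (isCompact_Icc.bddAbove_image hvc.abs).mono
      (Set.image_mono Set.Ioo_subset_Icc_self)
  have hM0 : 0 ≤ M := (sq_nonneg _).trans (hM x hx)
  -- difference polynomial
  set b : Fin (q + 1) → ℝ := fun j =>
    iteratedDerivWithin j g s xk / (Nat.factorial (j : ℕ) : ℝ) -
      cc j / (Nat.factorial (j : ℕ) : ℝ) with hb
  set d : ℝ → ℝ := fun y => ∑ j : Fin (q + 1), b j * (y - xk) ^ (j : ℕ) with hd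
  have hdc : Continuous d := by fun_prop
  have hTd : ∀ y, (∑ j ∈ Finset.range (q + 1), iteratedDerivWithin j g s xk /
      (Nat.factorial j : ℝ) * (y - xk) ^ j) * v y - Ph y = d y * v y := by
    intro y
    rw [hPh, Finset.sum_range, hd, Finset.sum_mul, Finset.sum_mul, ← Finset.sum_sub_distrib]
    apply Finset.sum_congr rfl
    intro j _
    simp only [hb]
    ring
  have hTe : ∀ y, taylorWithinEval g q s xk y = ∑ j ∈ Finset.range (q + 1),
      iteratedDerivWithin j g s xk / (Nat.factorial j : ℝ) * (y - xk) ^ j := by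
    intro y
    rw [taylor_within_apply]
    apply Finset.sum_congr rfl
    intro j _
    rw [smul_eq_mul]
    ring
  rw [hTd x, abs_mul]
  -- orthogonality against d
  have hPhc : ContinuousOn Ph (Set.Icc (xk - Δx / 2) (xk + Δx / 2)) := by
    rw [show Ph = _ from funext hPh]
    fun_prop
  have huint : IntegrableOn u (Set.Icc (xk - Δx / 2) (xk + Δx / 2)) := by
    rw [integrableOn_Icc_iff_integrableOn_Ioo]
    refine (cs_bound hab.le hu.continuousOn ?_).1
    simpa using hui 0 (by omega)
  have hrint : IntegrableOn (fun y => u y - Ph y) (Set.Icc (xk - Δx / 2) (xk + Δx / 2)) :=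
    huint.sub (hPhc.integrableOn_compact isCompact_Icc)
  have hmulint : ∀ φ : ℝ → ℝ, ContinuousOn φ (Set.Icc (xk - Δx / 2) (xk + Δx / 2)) →
      IntegrableOn (fun y => (u y - Ph y) * φ y) s := fun φ hφ =>
    (hrint.mul_continuousOn hφ isCompact_Icc).mono_set Set.Ioo_subset_Icc_self
  have horthd : ∫ y in s, (u y - Ph y) * (d y * v y) = 0 := by
    have hrw : ∀ y, (u y - Ph y) * (d y * v y) = ∑ j : Fin (q + 1),
        (b j * (Nat.factorial (j : ℕ) : ℝ)) *
          ((u y - Ph y) * ((y - xk) ^ (j : ℕ) * v y / (Nat.factorial (j : ℕ) : ℝ))) := by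
      intro y
      rw [hd, Finset.sum_mul, Finset.mul_sum]
      apply Finset.sum_congr rfl
      intro j _
      have : (Nat.factorial (j : ℕ) : ℝ) ≠ 0 := by positivity
      field_simp
    simp_rw [hrw]
    rw [integral_finsetSum]
    · apply Finset.sum_eq_zero
      intro j _
      rw [integral_const_mul, horth j, mul_zero]
    · intro j _
      apply Integrable.const_mul
      exact hmulint _ (by fun_prop)
  -- maximal value of d
  obtain ⟨x0, hx0, hmax⟩ := isCompact_Icc.exists_isMaxOn (Set.nonempty_Icc.2 hab.le)
    hdc.abs.continuousOn
  set S := |d x0| with hS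
  have hS0 : 0 ≤ S := abs_nonneg _
  have hdS : ∀ y ∈ s, |d y| ≤ S := fun y hy => hmax (Set.Ioo_subset_Icc_self hy)
  have h1 : c * Δx * S ^ 2 ≤ ∫ y in s, d y ^ 2 := by
    rw [hS, sq_abs]
    exact Hc xk Δx hΔ b x0 hx0
  have h2 : m ^ 2 * ∫ y in s, d y ^ 2 ≤ ∫ y in s, (E * S * M + (u y - Ph y) * (d y * v y)) := by
    rw [← integral_const_mul]
    apply setIntegral_mono_on
    · exact (((hdc.pow 2).const_mul (m ^ 2)).continuousOn.integrableOn_compact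
        isCompact_Icc).mono_set Set.Ioo_subset_Icc_self
    · exact (integrableOn_const (by simp [hs])).add (hmulint _ (hdc.continuousOn.mul hvc))
    · exact measurableSet_Ioo
    · intro y hy
      have hvy : v y ≠ 0 := hv0 y (Set.Ioo_subset_Icc_self hy)
      have hgv : g y * v y = u y := by simp only [hgdef]; field_simp
      have e1 := hTd y
      rw [← hTe] at e1
      set T := taylorWithinEval g q s xk y
      have e2 : d y ^ 2 * v y ^ 2 = (T - g y) * d y * v y ^ 2 + (u y - Ph y) * (d y * v y) := by
        have : d y ^ 2 * v y ^ 2 = (d y * v y) * (d y * v y) := by ring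
        rw [this]
        nth_rewrite 1 [← e1]
        rw [← hgv]
        ring
      have e3 : (T - g y) * d y * v y ^ 2 ≤ E * S * M := by
        calc (T - g y) * d y * v y ^ 2 ≤ |T - g y| * |d y| * v y ^ 2 := by
              rw [← abs_mul]
              exact mul_le_mul_of_nonneg_right (le_abs_self _) (sq_nonneg _)
          _ ≤ E * S * M := by
              gcongr
              · exact hT y hy
              · exact hdS y hy
              · exact hM y hy
      calc m ^ 2 * d y ^ 2 ≤ v y ^ 2 * d y ^ 2 :=
            mul_le_mul_of_nonneg_right (hvm y hy).le (sq_nonneg _)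
        _ = d y ^ 2 * v y ^ 2 := by ring
        _ ≤ _ := by rw [e2]; gcongr
  have hci : IntegrableOn (fun _ : ℝ => E * S * M) s := integrableOn_const (by simp [hs])
  rw [integral_add hci (hmulint (fun y => d y * v y) (hdc.continuousOn.mul hvc)),
    horthd, add_zero] at h2
  have hvol : ∫ _ in s, E * S * M = Δx * (E * S * M) := by
    rw [setIntegral_const, smul_eq_mul, hs, Real.volume_real_Ioo_of_le hab.le]
    ring
  rw [hvol] at h2
  have h3 : S ≤ 1 / c * E * (M / m ^ 2) := by
    rcases hS0.eq_or_lt with h0 | hpos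
    · rw [← h0]; positivity
    · have h4 : m ^ 2 * (c * Δx * S ^ 2) ≤ Δx * (E * S * M) :=
        (mul_le_mul_of_nonneg_left h1 (by positivity)).trans h2
      have h5 : (Δx * S) * (S * (c * m ^ 2)) ≤ (Δx * S) * (E * M) := by linarith
      have h6 := le_of_mul_le_mul_left h5 (by positivity)
      rw [show 1 / c * E * (M / m ^ 2) = E * M / (c * m ^ 2) by field_simp]
      rw [le_div_iff₀ (by positivity)]
      exact h6
  calc |d x| * |v x| ≤ S * N := by
        gcongr
        · exact hdS x hx
        · exact hN x hx
    _ ≤ (1 / c * E * (M / m ^ 2)) * N :=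
        mul_le_mul_of_nonneg_right h3 ((abs_nonneg _).trans (hN x hx))
    _ = _ := by rw [hE]; ring
end
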